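/- If the affine plane curve Pre(N,a) defined by f_c^N(x) = a is nonsingular, then it is irreducible (equivalently, the polynomial f_c^N(x) - a ∈ K[x,c] is irreducible). -/

import Mathlib

open MvPolynomial

namespace PreimageCurve

/-- A case of Capelli's lemma: substituting `X ^ 2`. -/
theorem irreducible_comp_sq {F : Type*} [Field F] {g : Polynomial F} (hg : Irreducible g)
    (hm : g.Monic) (h1 : IsSquare (-1 : F)) (h0 : ¬ IsSquare (g.coeff 0)) :
    Irreducible (g.comp (Polynomial.X ^ 2)) := by
  refine Polynomial.irreducible_comp hm (Polynomial.monic_X_pow 2) hg ?_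
  intro E _ _ x hx
  simp only [Polynomial.map_pow, Polynomial.map_X]
  apply X_pow_sub_C_irreducible_of_prime Nat.prime_two
  intro b hb
  apply h0
  have hxi : IsIntegral F x := by
    by_contra hni
    rw [minpoly.eq_zero hni] at hx
    exact hg.ne_zero hx.symm
  have hn := congrArg (Algebra.norm F) hb
  rw [map_pow, ← IntermediateField.adjoin.powerBasis_gen hxi,
    Algebra.PowerBasis.norm_gen_eq_coeff_zero_minpoly] at hn
  simp only [IntermediateField.adjoin.powerBasis_gen, IntermediateField.minpoly_gen, hx] at hn
  set d := (IntermediateField.adjoin.powerBasis hxi).dim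
  have h2 : IsSquare ((-1 : F) ^ d) := h1.pow d
  have h3 : g.coeff 0 = (-1 : F) ^ d * (Algebra.norm F b) ^ 2 := by
    rw [hn, ← mul_assoc, ← mul_pow]; simp
  rw [h3]
  exact h2.mul (IsSquare.sq _)

theorem irreducible_comp_sq_add {F : Type*} [Field F] {g : Polynomial F} (hg : Irreducible g)
    (hm : g.Monic) (h1 : IsSquare (-1 : F)) (t : F) (h0 : ¬ IsSquare (g.eval t)) :
    Irreducible (g.comp (Polynomial.X ^ 2 + Polynomial.C t)) := by
  have e : g.comp (Polynomial.X ^ 2 + Polynomial.C t) =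
      (g.comp (Polynomial.X + Polynomial.C t)).comp (Polynomial.X ^ 2) := by
    rw [Polynomial.comp_assoc]; simp
  rw [e]
  apply irreducible_comp_sq _ (hm.comp_X_add_C t) h1
  · rwa [Polynomial.coeff_zero_eq_eval_zero, Polynomial.eval_comp, Polynomial.eval_add,
      Polynomial.eval_X, Polynomial.eval_C, zero_add]
  · have := (MulEquiv.irreducible_iff (Polynomial.algEquivAevalXAddC t)).2 hg
    simpa [Polynomial.comp, Polynomial.aeval_def] using this

/-- The iterates of `x ^ 2 + t` starting at `x`. -/
def it {R : Type*} [CommRing R] (t x : R) : ℕ → R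
  | 0 => x
  | n + 1 => it t x n ^ 2 + t

theorem it_succ' {R : Type*} [CommRing R] (t x : R) (n : ℕ) :
    it t x (n + 1) = it t (x ^ 2 + t) n := by
  induction n with
  | zero => rfl
  | succ n ih => rw [it, ih, it]

theorem it_map {R S : Type*} [CommRing R] [CommRing S] (φ : R →+* S) (t x : R) (n : ℕ) :
    φ (it t x n) = it (φ t) (φ x) n := by
  induction n with
  | zero => rfl
  | succ n ih => simp [it, ih]

theorem it_eq {R : Type*} [CommRing R] (t x : R) (n : ℕ) :
    (fun p : R => p ^ 2 + t)^[n] x = it t x n := by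
  induction n with
  | zero => rfl
  | succ n ih => rw [Function.iterate_succ_apply', ih, it]

theorem it_monic {R : Type*} [CommRing R] [Nontrivial R] (t : R) (n : ℕ) :
    (it (Polynomial.C t) Polynomial.X n).Monic ∧
      (it (Polynomial.C t) Polynomial.X n).natDegree = 2 ^ n := by
  induction n with
  | zero => simp [it, Polynomial.monic_X]
  | succ n ih =>
    have hm := ih.1.pow 2
    have hd : (it (Polynomial.C t) Polynomial.X n ^ 2).natDegree = 2 ^ (n + 1) := by
      rw [ih.1.natDegree_pow, ih.2]; ring
    have hlt : (Polynomial.C t).degree <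
        (it (Polynomial.C t) Polynomial.X n ^ 2).degree := by
      rw [Polynomial.degree_eq_natDegree hm.ne_zero, hd]
      refine lt_of_le_of_lt Polynomial.degree_C_le ?_
      exact_mod_cast (by positivity : 0 < 2 ^ (n + 1))
    refine ⟨hm.add_of_left hlt, ?_⟩
    rw [it, Polynomial.natDegree_add_eq_left_of_degree_lt hlt, hd]

theorem it_sub_monic {R : Type*} [CommRing R] [Nontrivial R] (t a : R) (n : ℕ) :
    (it (Polynomial.C t) Polynomial.X n - Polynomial.C a).Monic := by
  obtain ⟨hm, hd⟩ := it_monic t n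
  refine hm.sub_of_left ?_
  rw [Polynomial.degree_eq_natDegree hm.ne_zero, hd]
  refine lt_of_le_of_lt Polynomial.degree_C_le ?_
  exact_mod_cast (by positivity : 0 < 2 ^ n)

theorem irreducible_it {F : Type*} [Field F] (t a : F) (h1 : IsSquare (-1 : F)) (N : ℕ)
    (h : ∀ n, n < N → ¬ IsSquare (it t 0 (n + 1) - a)) :
    Irreducible (it (Polynomial.C t) Polynomial.X N - Polynomial.C a) := by
  induction N with
  | zero => exact Polynomial.irreducible_X_sub_C a
  | succ N ih =>
    have ih' := ih (fun n hn => h n (by omega))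
    have e : it (Polynomial.C t) Polynomial.X (N + 1) - Polynomial.C a =
        (it (Polynomial.C t) Polynomial.X N - Polynomial.C a).comp
          (Polynomial.X ^ 2 + Polynomial.C t) := by
      have := it_map (Polynomial.compRingHom (Polynomial.X ^ 2 + Polynomial.C t))
        (Polynomial.C t) Polynomial.X N
      simp only [Polynomial.coe_compRingHom_apply, Polynomial.C_comp, Polynomial.X_comp] at this
      rw [it_succ', Polynomial.sub_comp, Polynomial.C_comp, this]
    rw [e]
    apply irreducible_comp_sq_add ih' (it_sub_monic t a N) h1
    have h2 := it_map (Polynomial.evalRingHom t) (Polynomial.C t) Polynomial.X N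
    simp only [Polynomial.coe_evalRingHom, Polynomial.eval_C, Polynomial.eval_X] at h2
    rw [Polynomial.eval_sub, Polynomial.eval_C, h2]
    have h3 := h N (by omega)
    rw [it_succ'] at h3
    simpa using h3

/-- Existence of iterated preimages of zero. -/
theorem exists_it_eq {K : Type*} [Field K] [IsAlgClosed K] (c y : K) (m : ℕ) :
    ∃ x, it c x m = y := by
  induction m generalizing y with
  | zero => exact ⟨y, rfl⟩
  | succ m ih =>
    obtain ⟨z, hz⟩ := IsAlgClosed.exists_pow_nat_eq (y - c) (n := 2) (by norm_num)
    obtain ⟨x, hx⟩ := ih z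
    exact ⟨x, by rw [it, hx, hz]; ring⟩

theorem natDegree_it_zero {K : Type*} [Field K] (n : ℕ) :
    (it (Polynomial.X : Polynomial K) 0 (n + 1)).natDegree = 2 ^ n := by
  induction n with
  | zero => simp [it]
  | succ n ih =>
    have hd : (it (Polynomial.X : Polynomial K) 0 (n + 1) ^ 2).natDegree = 2 ^ (n + 1) := by
      rw [Polynomial.natDegree_pow, ih]; ring
    rw [it, Polynomial.natDegree_add_eq_left_of_natDegree_lt, hd]
    rw [hd, Polynomial.natDegree_X]
    exact Nat.one_lt_two_pow (by omega)

theorem eval_it {K : Type*} [Field K] (x c : K) (n : ℕ) :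
    MvPolynomial.eval ![x, c] (it (X 1 : MvPolynomial (Fin 2) K) (X 0) n) = it c x n := by
  rw [it_map]; simp

/-- Nonsingularity implies that `f_c^n(0) - a` is not a square in `K[c]`. -/
theorem not_square {K : Type*} [Field K] [IsAlgClosed K] (a : K) (N : ℕ)
    (hns : ∀ x c : K,
      MvPolynomial.eval ![x, c] (it (X 1 : MvPolynomial (Fin 2) K) (X 0) N) = a →
      ¬(MvPolynomial.eval ![x, c] (pderiv 0 (it (X 1 : MvPolynomial (Fin 2) K) (X 0) N)) = 0 ∧
        MvPolynomial.eval ![x, c] (pderiv 1 (it (X 1 : MvPolynomial (Fin 2) K) (X 0) N)) = 0))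
    (n : ℕ) (hn : n < N) :
    ¬ IsSquare (it (Polynomial.X : Polynomial K) 0 (n + 1) - Polynomial.C a) := by
  rintro ⟨h, hh⟩
  have hdeg : 2 ^ n = h.natDegree + h.natDegree := by
    rw [← natDegree_it_zero (K := K) n, ← Polynomial.natDegree_sub_C (a := a), hh,
      ← pow_two, Polynomial.natDegree_pow, two_mul]
  have hpos : h.degree ≠ 0 := by
    intro h0
    have h00 : h.natDegree = 0 := Polynomial.natDegree_eq_zero_iff_degree_le_zero.2 h0.le
    have : 0 < 2 ^ n := by positivity
    omega
  obtain ⟨c, hc⟩ := IsAlgClosed.exists_root h hpos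
  rw [Polynomial.IsRoot] at hc
  have hp : it (Polynomial.X : Polynomial K) 0 (n + 1) = h * h + Polynomial.C a := by
    rw [← hh]; ring
  have hv : (it (Polynomial.X : Polynomial K) 0 (n + 1)).eval c = a := by
    rw [hp]; simp [hc]
  have hd : (Polynomial.derivative (it (Polynomial.X : Polynomial K) 0 (n + 1))).eval c = 0 := by
    rw [hp]; simp [hc]
  obtain ⟨x, hx⟩ := exists_it_eq c 0 (N - (n + 1))
  have key : ∀ k,
      MvPolynomial.eval ![x, c]
        (it (X 1 : MvPolynomial (Fin 2) K) (X 0) (N - (n + 1) + (k + 1))) =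
        (it (Polynomial.X : Polynomial K) 0 (k + 1)).eval c ∧
      MvPolynomial.eval ![x, c] (pderiv 0
        (it (X 1 : MvPolynomial (Fin 2) K) (X 0) (N - (n + 1) + (k + 1)))) = 0 ∧
      MvPolynomial.eval ![x, c] (pderiv 1
        (it (X 1 : MvPolynomial (Fin 2) K) (X 0) (N - (n + 1) + (k + 1)))) =
        (Polynomial.derivative (it (Polynomial.X : Polynomial K) 0 (k + 1))).eval c := by
    intro k
    induction k with
    | zero =>
      have hx' := eval_it x c (N - (n + 1))
      rw [hx] at hx'
      simp [it, hx', pderiv_X]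
    | succ k ih =>
      obtain ⟨i1, i2, i3⟩ := ih
      rw [← add_assoc _ (k + 1) 1, it, it]
      simp [pderiv_X, i1, i2, i3, Polynomial.derivative_pow]
      ring
  obtain ⟨k1, k2, k3⟩ := key n
  rw [Nat.sub_add_cancel (by omega : n + 1 ≤ N)] at k1 k2 k3
  exact hns x c (k1.trans hv) ⟨k2, k3.trans hd⟩

end PreimageCurve

open PreimageCurve in
/-- If the plane curve `Pre(N,a) : f_c^N(x) = a` is nonsingular, then it is irreducible:
the polynomial `f_c^N(x) - a ∈ K[x,c]` is irreducible. -/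
theorem preimage_curve_nonsingular_irreducible {K : Type*} [Field K] [IsAlgClosed K]
    (hchar : (2 : K) ≠ 0) (a : K) (N : ℕ) (hN : 1 ≤ N)
    (hns : ∀ x c : K,
      MvPolynomial.eval ![x, c]
          ((fun p : MvPolynomial (Fin 2) K => p ^ 2 + X 1)^[N] (X 0)) = a →
      ¬(MvPolynomial.eval ![x, c] (pderiv 0
            ((fun p : MvPolynomial (Fin 2) K => p ^ 2 + X 1)^[N] (X 0))) = 0 ∧
        MvPolynomial.eval ![x, c] (pderiv 1
            ((fun p : MvPolynomial (Fin 2) K => p ^ 2 + X 1)^[N] (X 0))) = 0)) :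
    Irreducible
      ((fun p : MvPolynomial (Fin 2) K => p ^ 2 + X 1)^[N] (X 0) - C a) := by
  simp only [it_eq] at hns ⊢
  have hsq := not_square a N hns
  let R := MvPolynomial (Fin 1) K
  let F := FractionRing R
  rw [← MulEquiv.irreducible_iff (finSuccEquiv K 1)]
  have e : finSuccEquiv K 1 (it (X 1 : MvPolynomial (Fin 2) K) (X 0) N - C a) =
      it (Polynomial.C (X 0 : R)) Polynomial.X N - Polynomial.C (C a : R) := by
    have h1 := it_map (finSuccEquiv K 1 : MvPolynomial (Fin 2) K →+* Polynomial R) (X 1) (X 0) N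
    have h2 : finSuccEquiv K 1 (X 1) = Polynomial.C (X 0 : R) :=
      finSuccEquiv_X_succ (j := (0 : Fin 1))
    have h3 : finSuccEquiv K 1 (C a) = Polynomial.C (C a : R) := by
      simp [finSuccEquiv_apply]
    simp only [RingHom.coe_coe, h2, finSuccEquiv_X_zero] at h1
    rw [map_sub, h1, h3]
  rw [e, Polynomial.Monic.irreducible_iff_irreducible_map_fraction_map (K := F)
    (it_sub_monic _ _ _)]
  have e2 : (it (Polynomial.C (X 0 : R)) Polynomial.X N - Polynomial.C (C a : R)).map
      (algebraMap R F) = it (Polynomial.C (algebraMap R F (X 0))) Polynomial.X N -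
        Polynomial.C (algebraMap R F (C a)) := by
    have h1 := it_map (Polynomial.mapRingHom (algebraMap R F)) (Polynomial.C (X 0 : R))
      Polynomial.X N
    simp only [Polynomial.coe_mapRingHom, Polynomial.map_C, Polynomial.map_X] at h1
    rw [Polynomial.map_sub, h1, Polynomial.map_C]
  rw [e2]
  apply irreducible_it
  · obtain ⟨i, hi⟩ := IsAlgClosed.exists_pow_nat_eq (-1 : K) (n := 2) (by norm_num)
    refine ⟨algebraMap R F (C i), ?_⟩
    rw [← map_mul, ← map_mul, ← pow_two, hi]
    simp
  · rintro n hn ⟨y, hy⟩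
    apply hsq n hn
    have e3 : algebraMap R F (it (X 0) 0 (n + 1) - C a) =
        it (algebraMap R F (X 0)) 0 (n + 1) - algebraMap R F (C a) := by
      rw [map_sub, it_map, map_zero]
    rw [← e3, ← pow_two] at hy
    obtain ⟨r, hr⟩ := IsIntegrallyClosed.exists_algebraMap_eq_of_isIntegral_pow (R := R)
      (x := y) (n := 2) (by norm_num) (hy ▸ isIntegral_algebraMap)
    rw [← hr, ← map_pow] at hy
    have hy' := IsFractionRing.injective R F hy
    have h4 := congrArg (aeval (fun _ : Fin 1 => (Polynomial.X : Polynomial K))) hy'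
    have h5 := it_map (aeval (R := K)
      (fun _ : Fin 1 => (Polynomial.X : Polynomial K))).toRingHom (X 0) 0 (n + 1)
    simp only [AlgHom.toRingHom_eq_coe, RingHom.coe_coe, aeval_X, map_zero] at h5
    rw [map_sub, h5, map_pow, aeval_C] at h4
    exact ⟨_, h4.trans (pow_two _)⟩
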